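/- Assume hypotheses (H1)–(H3), let q0, q be chosen with 1 − 1/p < 1/q0 < min{β, δα, δ/p, 1/2} and 1/(q0·δ) ≤ 1/q < min{α, 1/p}, let ω : [0,T] → ℝ^m be continuous of finite p-variation, and let [t0,t1] ⊆ [0,T]. Define F(x)_t := x_{t0} + ∫_{t0}^t f(s,x_s) ds + ∫_{t0}^t g(s,x_s) dω_s for t ∈ [t0,t1]. Then for every continuous x : [t0,t1] → ℝ^d of finite q-variation, F(x) is a well-defined continuous path of finite q-variation on [t0,t1], and |||F(x)|||_{q-var,[t0,t1]} ≤ M(K+2) · (1 + ‖x‖_{q-var,[t0,t1]}) · ( (t1 − t0)^α + |||ω|||_{p-var,[t0,t1]} ), where K := (1 − 2^{1−θ})^{−1} with θ := 1/p + 1/q0, and M := max{L_g, a·T^{1−α}, |g(0,0)| + h(0,T)^β, ‖b‖_{L_{1/(1−α)}}}. -/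

import Mathlib

open scoped BigOperators
open Set

noncomputable section

/-- Euclidean space `ℝ^n`. -/
abbrev Ed (n : ℕ) : Type := EuclideanSpace ℝ (Fin n)

section PVarDefs

variable {E F : Type*} [NormedAddCommGroup E] [NormedSpace ℝ E]
  [NormedAddCommGroup F] [NormedSpace ℝ F]

/-- The set of sums `Σ_i ‖x (t (i+1)) - x (t i)‖ ^ p` over all finite partitions
`a = t 0 < t 1 < ⋯ < t n = b` of `[a,b]`. -/
def pVarSums (p : ℝ) (x : ℝ → E) (a b : ℝ) : Set ℝ :=
  { v | ∃ n : ℕ, ∃ t : Fin (n + 1) → ℝ, StrictMono t ∧ t 0 = a ∧ t (Fin.last n) = b ∧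
      v = ∑ i : Fin n, ‖x (t i.succ) - x (t i.castSucc)‖ ^ p }

/-- The `p`-variation seminorm `|||x|||_{p-var,[a,b]}`. -/
def pVar (p : ℝ) (x : ℝ → E) (a b : ℝ) : ℝ :=
  sSup (pVarSums p x a b) ^ (1 / p)

/-- `x` is of finite `p`-variation on `[a,b]`. -/
def FinitePVar (p : ℝ) (x : ℝ → E) (a b : ℝ) : Prop :=
  BddAbove (pVarSums p x a b)

/-- The `p`-variation norm `‖x‖_{p-var,[a,b]} = ‖x a‖ + |||x|||_{p-var,[a,b]}`. -/
def pVarNorm (p : ℝ) (x : ℝ → E) (a b : ℝ) : ℝ :=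
  ‖x a‖ + pVar p x a b

/-- A control function on `[a,b]`: continuous on the simplex, vanishing on the diagonal,
superadditive and nonnegative. -/
def IsControlOn (a b : ℝ) (w : ℝ → ℝ → ℝ) : Prop :=
  ContinuousOn (fun pr : ℝ × ℝ => w pr.1 pr.2) {pr : ℝ × ℝ | a ≤ pr.1 ∧ pr.1 ≤ pr.2 ∧ pr.2 ≤ b} ∧
  (∀ t : ℝ, a ≤ t → t ≤ b → w t t = 0) ∧
  (∀ s t u : ℝ, a ≤ s → s ≤ t → t ≤ u → u ≤ b → w s t + w t u ≤ w s u) ∧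
  (∀ s t : ℝ, a ≤ s → s ≤ t → t ≤ b → 0 ≤ w s t)

/-- A tagged partition `a = t 0 < t 1 < ⋯ < t n = b` of `[a,b]`, with tags
`tag i ∈ [t i, t (i+1)]`. -/
structure TaggedPartition (a b : ℝ) where
  n : ℕ
  t : Fin (n + 1) → ℝ
  tag : Fin n → ℝ
  mono : StrictMono t
  first : t 0 = a
  last : t (Fin.last n) = b
  tag_mem : ∀ i : Fin n, tag i ∈ Set.Icc (t i.castSucc) (t i.succ)

/-- The mesh of a tagged partition. -/
def TaggedPartition.mesh {a b : ℝ} (P : TaggedPartition a b) : ℝ :=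
  ⨆ i : Fin P.n, (P.t i.succ - P.t i.castSucc)

/-- Riemann–Stieltjes sum of `x` against `ω` along a tagged partition. -/
def RSSum (x : ℝ → E →L[ℝ] F) (ω : ℝ → E) {a b : ℝ} (P : TaggedPartition a b) : F :=
  ∑ i : Fin P.n, x (P.tag i) (ω (P.t i.succ) - ω (P.t i.castSucc))

/-- `v` is the Young integral `∫_a^b x dω`: the Riemann–Stieltjes sums converge to `v`
as the mesh tends to `0`. -/
def IsYoungIntegral (x : ℝ → E →L[ℝ] F) (ω : ℝ → E) (a b : ℝ) (v : F) : Prop :=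
  ∀ ε : ℝ, 0 < ε → ∃ δ : ℝ, 0 < δ ∧
    ∀ P : TaggedPartition a b, P.mesh < δ → ‖RSSum x ω P - v‖ < ε

/-- The Young integral `∫_a^b x dω` (an arbitrary value, `0`, if the limit does not exist). -/
def youngIntegral (x : ℝ → E →L[ℝ] F) (ω : ℝ → E) (a b : ℝ) : F :=
  letI := Classical.propDecidable (∃ v, IsYoungIntegral x ω a b v)
  if hv : ∃ v, IsYoungIntegral x ω a b v then hv.choose else 0

end PVarDefs

/-- The map `F(x)_t = x t0 + ∫_{t0}^t f(s, x s) ds + ∫_{t0}^t g(s, x s) dω_s`. -/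
def Fmap {d m : ℕ} (f : ℝ → Ed d → Ed d) (g : ℝ → Ed d → (Ed m →L[ℝ] Ed d))
    (ω : ℝ → Ed m) (t0 : ℝ) (x : ℝ → Ed d) : ℝ → Ed d :=
  fun t => x t0 + (∫ s in t0..t, f s (x s)) + youngIntegral (fun s => g s (x s)) ω t0 t


/-- A nonnegative superadditive function of pairs `s ≤ t` in `[a,b]`. -/
structure IsSuperadditiveOn (a b : ℝ) (W : ℝ → ℝ → ℝ) : Prop where
  nonneg : ∀ s t : ℝ, a ≤ s → s ≤ t → t ≤ b → 0 ≤ W s t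
  add_le : ∀ s t u : ℝ, a ≤ s → s ≤ t → t ≤ u → u ≤ b → W s t + W t u ≤ W s u

namespace IsSuperadditiveOn

variable {a b : ℝ} {W : ℝ → ℝ → ℝ}

lemma mono_Icc (hW : IsSuperadditiveOn a b W) {s t : ℝ} (hs : a ≤ s) (ht : t ≤ b) :
    IsSuperadditiveOn s t W where
  nonneg u v h1 h2 h3 := hW.nonneg u v (hs.trans h1) h2 (h3.trans ht)
  add_le u v w h1 h2 h3 h4 := hW.add_le u v w (hs.trans h1) h2 h3 (h4.trans ht)

lemma self_eq_zero (hW : IsSuperadditiveOn a b W) {s : ℝ} (hs : a ≤ s) (hs' : s ≤ b) :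
    W s s = 0 := by
  have h1 := hW.nonneg s s hs le_rfl hs'
  have h2 := hW.add_le s s s hs le_rfl le_rfl hs'
  linarith

lemma mono (hW : IsSuperadditiveOn a b W) {s u v t : ℝ} (hs : a ≤ s) (hsu : s ≤ u)
    (huv : u ≤ v) (hvt : v ≤ t) (ht : t ≤ b) : W u v ≤ W s t := by
  have h1 := hW.add_le s u t hs hsu (huv.trans hvt) ht
  have h2 := hW.add_le u v t (hs.trans hsu) huv hvt ht
  have h3 := hW.nonneg s u hs hsu ((huv.trans hvt).trans ht)
  have h4 := hW.nonneg v t ((hs.trans hsu).trans huv) hvt ht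
  linarith

lemma sum_le (hW : IsSuperadditiveOn a b W) (τ : ℕ → ℝ) (n : ℕ)
    (hτ : ∀ i < n, τ i ≤ τ (i + 1)) (h0 : a ≤ τ 0) (hn : τ n ≤ b) :
    τ 0 ≤ τ n ∧ ∑ i ∈ Finset.range n, W (τ i) (τ (i + 1)) ≤ W (τ 0) (τ n) := by
  induction n with
  | zero => simpa using hW.nonneg (τ 0) (τ 0) h0 le_rfl hn
  | succ n ih =>
    have hlast := hτ n (Nat.lt_succ_self n)
    obtain ⟨h1, h2⟩ := ih (fun i hi => hτ i (hi.trans (Nat.lt_succ_self n))) (hlast.trans hn)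
    refine ⟨h1.trans hlast, ?_⟩
    rw [Finset.sum_range_succ]
    have := hW.add_le _ _ _ h0 h1 hlast hn
    linarith

lemma rpow (hW : IsSuperadditiveOn a b W) {γ : ℝ} (hγ : 1 ≤ γ) :
    IsSuperadditiveOn a b (fun s t => W s t ^ γ) where
  nonneg s t h1 h2 h3 := Real.rpow_nonneg (hW.nonneg s t h1 h2 h3) _
  add_le s t u h1 h2 h3 h4 := by
    have k1 := hW.nonneg s t h1 h2 (h3.trans h4)
    have k2 := hW.nonneg t u (h1.trans h2) h3 h4
    exact (Real.add_rpow_le_rpow_add k1 k2 hγ).trans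
      (Real.rpow_le_rpow (add_nonneg k1 k2) (hW.add_le s t u h1 h2 h3 h4) (by linarith))

end IsSuperadditiveOn

lemma rpow_mul_rpow_add_le {a₁ a₂ b₁ b₂ x y : ℝ} (ha₁ : 0 ≤ a₁) (ha₂ : 0 ≤ a₂)
    (hb₁ : 0 ≤ b₁) (hb₂ : 0 ≤ b₂) (hx : 0 < x) (hy : 0 < y) (hxy : x + y = 1) :
    a₁ ^ x * b₁ ^ y + a₂ ^ x * b₂ ^ y ≤ (a₁ + a₂) ^ x * (b₁ + b₂) ^ y := by
  rcases (add_nonneg ha₁ ha₂).eq_or_lt' with h | hA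
  · have h1 : a₁ = 0 := by linarith
    have h2 : a₂ = 0 := by linarith
    simp [h1, h2, Real.zero_rpow hx.ne']
  rcases (add_nonneg hb₁ hb₂).eq_or_lt' with h | hB
  · have h1 : b₁ = 0 := by linarith
    have h2 : b₂ = 0 := by linarith
    simp [h1, h2, Real.zero_rpow hy.ne']
  have key : ∀ {c e : ℝ}, 0 ≤ c → 0 ≤ e → c ^ x * e ^ y ≤
      (x * (c / (a₁ + a₂)) + y * (e / (b₁ + b₂))) * ((a₁ + a₂) ^ x * (b₁ + b₂) ^ y) := by
    intro c e hc he
    have := Real.geom_mean_le_arith_mean2_weighted hx.le hy.le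
      (div_nonneg hc hA.le) (div_nonneg he hB.le) hxy
    rw [Real.div_rpow hc hA.le, Real.div_rpow he hB.le] at this
    have hA' := Real.rpow_pos_of_pos hA x
    have hB' := Real.rpow_pos_of_pos hB y
    rw [div_mul_div_comm, div_le_iff₀ (mul_pos hA' hB')] at this
    exact this
  refine (add_le_add (key ha₁ hb₁) (key ha₂ hb₂)).trans_eq ?_
  rw [← add_mul]
  have : x * (a₁ / (a₁ + a₂)) + y * (b₁ / (b₁ + b₂)) +
      (x * (a₂ / (a₁ + a₂)) + y * (b₂ / (b₁ + b₂))) = 1 := by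
    have e1 : a₁ / (a₁ + a₂) + a₂ / (a₁ + a₂) = 1 := by
      rw [← add_div, div_self hA.ne']
    have e2 : b₁ / (b₁ + b₂) + b₂ / (b₁ + b₂) = 1 := by
      rw [← add_div, div_self hB.ne']
    linear_combination x * e1 + y * e2 + hxy
  rw [this, one_mul]

lemma IsSuperadditiveOn.rpow_mul_rpow {a b : ℝ} {A B : ℝ → ℝ → ℝ}
    (hA : IsSuperadditiveOn a b A) (hB : IsSuperadditiveOn a b B) {x y : ℝ}
    (hx : 0 < x) (hy : 0 < y) (hxy : x + y = 1) :
    IsSuperadditiveOn a b (fun s t => A s t ^ x * B s t ^ y) where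
  nonneg s t h1 h2 h3 := mul_nonneg (Real.rpow_nonneg (hA.nonneg s t h1 h2 h3) _)
    (Real.rpow_nonneg (hB.nonneg s t h1 h2 h3) _)
  add_le s t u h1 h2 h3 h4 := by
    have k1 := hA.nonneg s t h1 h2 (h3.trans h4)
    have k2 := hA.nonneg t u (h1.trans h2) h3 h4
    have l1 := hB.nonneg s t h1 h2 (h3.trans h4)
    have l2 := hB.nonneg t u (h1.trans h2) h3 h4
    refine (rpow_mul_rpow_add_le k1 k2 l1 l2 hx hy hxy).trans ?_
    have := hA.add_le s t u h1 h2 h3 h4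
    have := hB.add_le s t u h1 h2 h3 h4
    have := Real.rpow_nonneg (hA.nonneg s u h1 (h2.trans h3) h4) x
    gcongr

lemma two_mul_half_rpow {w θ : ℝ} (hw : 0 ≤ w) :
    2 * (w / 2) ^ θ = (2:ℝ) ^ (1 - θ) * w ^ θ := by
  rw [Real.div_rpow hw (by norm_num), Real.rpow_sub (by norm_num), Real.rpow_one]
  ring

lemma two_rpow_one_sub_lt_one {θ : ℝ} (hθ : 1 < θ) : (2:ℝ) ^ (1 - θ) < 1 :=
  Real.rpow_lt_one_of_one_lt_of_neg (by norm_num) (by linarith)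

/-- The element of the finite set `D` following `z`. -/
def nextPoint (D : Finset ℝ) (z : ℝ) : ℝ := sInf {w : ℝ | w ∈ D ∧ z < w}

lemma nextPoint_spec {D : Finset ℝ} {z v : ℝ} (hv : v ∈ D) (hzv : z < v) :
    nextPoint D z ∈ D ∧ z < nextPoint D z ∧ ∀ w ∈ D, z < w → nextPoint D z ≤ w := by
  have hfin : {w : ℝ | w ∈ D ∧ z < w}.Finite := D.finite_toSet.subset fun w hw => hw.1
  have hmem := Set.Nonempty.csInf_mem (s := {w : ℝ | w ∈ D ∧ z < w}) ⟨v, hv, hzv⟩ hfin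
  exact ⟨hmem.1, hmem.2, fun w hw hzw => csInf_le hfin.bddBelow ⟨hw, hzw⟩⟩

section Sewing

variable {F : Type*} [NormedAddCommGroup F]

/-- The sum of `Ξ` over consecutive points of `D` in `[u,v]`. -/
def gridSum (Ξ : ℝ → ℝ → F) (D : Finset ℝ) (u v : ℝ) : F :=
  ∑ z ∈ D with u ≤ z ∧ z < v, Ξ z (nextPoint D z)

lemma gridSum_add (Ξ : ℝ → ℝ → F) (D : Finset ℝ) {u v w : ℝ} (huv : u ≤ v) (hvw : v ≤ w) :
    gridSum Ξ D u v + gridSum Ξ D v w = gridSum Ξ D u w := by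
  unfold gridSum
  rw [← Finset.sum_union]
  · congr 1
    ext z
    simp only [Finset.mem_union, Finset.mem_filter]
    constructor
    · rintro (⟨h1, h2, h3⟩ | ⟨h1, h2, h3⟩)
      · exact ⟨h1, h2, h3.trans_le hvw⟩
      · exact ⟨h1, huv.trans h2, h3⟩
    · rintro ⟨h1, h2, h3⟩
      rcases lt_or_ge z v with h | h
      · exact Or.inl ⟨h1, h2, h⟩
      · exact Or.inr ⟨h1, h, h3⟩
  · rw [Finset.disjoint_left]
    intro z h1 h2
    simp only [Finset.mem_filter] at h1 h2
    linarith [h1.2.2, h2.2.1]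

lemma gridSum_nextPoint (Ξ : ℝ → ℝ → F) {D : Finset ℝ} {z v : ℝ} (hz : z ∈ D) (hv : v ∈ D)
    (hzv : z < v) : gridSum Ξ D z (nextPoint D z) = Ξ z (nextPoint D z) := by
  obtain ⟨-, h2, h3⟩ := nextPoint_spec hv hzv
  unfold gridSum
  have : D.filter (fun w => z ≤ w ∧ w < nextPoint D z) = {z} := by
    ext w
    simp only [Finset.mem_filter, Finset.mem_singleton]
    constructor
    · rintro ⟨k1, k2, k3⟩
      by_contra hne
      exact absurd (h3 w k1 (lt_of_le_of_ne k2 (Ne.symm hne))) (not_le.2 k3)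
    · rintro rfl
      exact ⟨hz, le_rfl, h2⟩
  rw [this, Finset.sum_singleton]

lemma norm_gridSum_sub_le {Ξ : ℝ → ℝ → F} {V : ℝ → ℝ → ℝ} {s t θ c : ℝ}
    (hV : IsSuperadditiveOn s t V) (hθ : 1 < θ) (hc : 0 ≤ c)
    (hΞ0 : ∀ u, Ξ u u = 0)
    (hΞ : ∀ u v w, s ≤ u → u ≤ v → v ≤ w → w ≤ t →
      ‖Ξ u w - Ξ u v - Ξ v w‖ ≤ c * V u w ^ θ)
    (D : Finset ℝ) (u v : ℝ) (hu : u ∈ D) (hv : v ∈ D) (hsu : s ≤ u) (huv : u ≤ v) (hvt : v ≤ t) :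
    ‖gridSum Ξ D u v - Ξ u v‖ ≤ 2 * c * (1 - (2:ℝ) ^ (1 - θ))⁻¹ * V u v ^ θ := by
  set K := (1 - (2:ℝ) ^ (1 - θ))⁻¹ with hK
  have hlam := two_rpow_one_sub_lt_one hθ
  have hKpos : 0 < K := inv_pos.2 (by linarith)
  have hKeq : K * (2:ℝ) ^ (1 - θ) + 1 = K := by
    have : K * (1 - (2:ℝ) ^ (1 - θ)) = 1 := inv_mul_cancel₀ (by linarith)
    linarith
  induction hn : (D.filter (fun z => u ≤ z ∧ z < v)).card using Nat.strong_induction_on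
    generalizing u v with
  | _ n ih =>
  have hVuv := hV.nonneg u v hsu huv hvt
  rcases huv.eq_or_lt with rfl | hlt
  · have : gridSum Ξ D u u = 0 := by
      unfold gridSum
      apply Finset.sum_eq_zero
      intro z hz
      simp only [Finset.mem_filter] at hz
      linarith [hz.2.1, hz.2.2]
    rw [this, hΞ0, sub_zero, norm_zero]
    positivity
  set L := D.filter (fun z => (u ≤ z ∧ z < v) ∧ V u z ≤ V u v / 2) with hL
  have huL : u ∈ L := by
    simp only [hL, Finset.mem_filter]
    refine ⟨hu, ⟨le_rfl, hlt⟩, ?_⟩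
    rw [hV.self_eq_zero hsu (huv.trans hvt)]
    linarith
  obtain ⟨k, hkL, hkmax⟩ := L.exists_max_image id ⟨u, huL⟩
  simp only [hL, Finset.mem_filter, id] at hkL hkmax
  obtain ⟨hkD, ⟨huk, hkv⟩, hVk⟩ := hkL
  obtain ⟨hk'D, hkk', hk'min⟩ := nextPoint_spec hv hkv
  set k' := nextPoint D k with hk'
  have hk'v : k' ≤ v := hk'min v hv hkv
  have huk' : u ≤ k' := huk.trans hkk'.le
  have hVk' : V k' v ≤ V u v / 2 := by
    rcases hk'v.eq_or_lt with h | h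
    · rw [h, hV.self_eq_zero (hsu.trans huv) hvt]
      linarith
    · have h1 : V u v / 2 < V u k' := by
        by_contra hcon
        have := hkmax k' ⟨hk'D, ⟨huk', h⟩, not_lt.1 hcon⟩
        linarith
      have := hV.add_le u k' v hsu huk' hk'v hvt
      linarith
  have ih1 := ih (D.filter (fun z => u ≤ z ∧ z < k)).card (by
    rw [← hn]
    refine Finset.card_lt_card ⟨fun z hz => ?_, fun hsub => ?_⟩
    · simp only [Finset.mem_filter] at hz ⊢
      exact ⟨hz.1, hz.2.1, hz.2.2.trans hkv⟩
    · have := hsub (Finset.mem_filter.2 ⟨hkD, huk, hkv⟩)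
      simp at this) u k hu hkD hsu huk (hkv.le.trans hvt) rfl
  have ih2 := ih (D.filter (fun z => k' ≤ z ∧ z < v)).card (by
    rw [← hn]
    refine Finset.card_lt_card ⟨fun z hz => ?_, fun hsub => ?_⟩
    · simp only [Finset.mem_filter] at hz ⊢
      exact ⟨hz.1, huk'.trans hz.2.1, hz.2.2⟩
    · have := hsub (Finset.mem_filter.2 ⟨hkD, huk, hkv⟩)
      simp only [Finset.mem_filter] at this
      linarith [this.2.1]) k' v hk'D hv (hsu.trans huk') hk'v hvt rfl
  have d1 := hΞ u k v hsu huk hkv.le hvt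
  have d2 := hΞ k k' v (hsu.trans huk) hkk'.le hk'v hvt
  have hVkv : V k v ^ θ ≤ V u v ^ θ :=
    Real.rpow_le_rpow (hV.nonneg k v (hsu.trans huk) hkv.le hvt)
      (hV.mono hsu huk hkv.le le_rfl hvt) (by linarith)
  have e1 : V u k ^ θ ≤ (V u v / 2) ^ θ :=
    Real.rpow_le_rpow (hV.nonneg u k hsu huk (hkv.le.trans hvt)) hVk (by linarith)
  have e2 : V k' v ^ θ ≤ (V u v / 2) ^ θ :=
    Real.rpow_le_rpow (hV.nonneg k' v (hsu.trans huk') hk'v hvt) hVk' (by linarith)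
  have hsplit : gridSum Ξ D u v - Ξ u v = (gridSum Ξ D u k - Ξ u k) +
      (gridSum Ξ D k' v - Ξ k' v) - (Ξ u v - Ξ u k - Ξ k v) - (Ξ k v - Ξ k k' - Ξ k' v) := by
    rw [← gridSum_add Ξ D huk hkv.le, ← gridSum_add Ξ D hkk'.le hk'v,
      gridSum_nextPoint Ξ hkD hv hkv]
    abel
  rw [hsplit]
  have htri : ‖(gridSum Ξ D u k - Ξ u k) + (gridSum Ξ D k' v - Ξ k' v) -
      (Ξ u v - Ξ u k - Ξ k v) - (Ξ k v - Ξ k k' - Ξ k' v)‖ ≤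
      ‖gridSum Ξ D u k - Ξ u k‖ + ‖gridSum Ξ D k' v - Ξ k' v‖ +
      ‖Ξ u v - Ξ u k - Ξ k v‖ + ‖Ξ k v - Ξ k k' - Ξ k' v‖ :=
    (norm_sub_le _ _).trans (add_le_add_left ((norm_sub_le _ _).trans
      (add_le_add_left (norm_add_le _ _) _)) _)
  have hhalf := two_mul_half_rpow (θ := θ) hVuv
  have m1 := mul_le_mul_of_nonneg_left e1 (show 0 ≤ 2 * c * K by positivity)
  have m2 := mul_le_mul_of_nonneg_left e2 (show 0 ≤ 2 * c * K by positivity)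
  have m3 := mul_le_mul_of_nonneg_left hVkv hc
  calc _ ≤ 2 * c * K * (2 * (V u v / 2) ^ θ) + 2 * c * V u v ^ θ := by linarith
    _ = 2 * c * (K * (2:ℝ) ^ (1 - θ) + 1) * V u v ^ θ := by rw [hhalf]; ring
    _ = _ := by rw [hKeq]

open Filter Topology in
/-- Sewing lemma: an almost additive `Ξ` is the increment of a path up to an error which is
controlled on every subinterval by any control of the defect of additivity there. -/
lemma exists_sewing [ProperSpace F] {Ξ : ℝ → ℝ → F} {a b : ℝ} {V₀ : ℝ → ℝ → ℝ} {θ₀ : ℝ}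
    (hV₀ : IsSuperadditiveOn a b V₀) (hθ₀ : 1 < θ₀) (hΞ0 : ∀ u, Ξ u u = 0)
    (hΞ : ∀ u v w, a ≤ u → u ≤ v → v ≤ w → w ≤ b →
      ‖Ξ u w - Ξ u v - Ξ v w‖ ≤ V₀ u w ^ θ₀) :
    ∃ J : ℝ → F, ∀ (s t : ℝ) (V : ℝ → ℝ → ℝ) (θ c : ℝ), a ≤ s → s ≤ t → t ≤ b →
      IsSuperadditiveOn s t V → 1 < θ → 0 ≤ c →
      (∀ u v w, s ≤ u → u ≤ v → v ≤ w → w ≤ t →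
        ‖Ξ u w - Ξ u v - Ξ v w‖ ≤ c * V u w ^ θ) →
      ‖J t - J s - Ξ s t‖ ≤ 2 * c * (1 - (2:ℝ) ^ (1 - θ))⁻¹ * V s t ^ θ := by
  let U : Ultrafilter (Finset ℝ) := Ultrafilter.of atTop
  have hU : (U : Filter (Finset ℝ)) ≤ atTop := Ultrafilter.of_le _
  have hev : ∀ u : ℝ, ∀ᶠ D in (U : Filter (Finset ℝ)), u ∈ D := fun u =>
    hU ((eventually_ge_atTop ({u} : Finset ℝ)).mono fun D hD => hD (Finset.mem_singleton_self u))
  have hlim : ∀ v : ℝ, ∃ y : F, a ≤ v → v ≤ b →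
      Tendsto (fun D => gridSum Ξ D a v) (U : Filter (Finset ℝ)) (𝓝 y) := by
    intro v
    by_cases hv : a ≤ v ∧ v ≤ b
    · obtain ⟨y, -, hy⟩ := (isCompact_closedBall (Ξ a v)
        (2 * 1 * (1 - (2:ℝ) ^ (1 - θ₀))⁻¹ * V₀ a v ^ θ₀)).ultrafilter_le_nhds
        (U.map fun D => gridSum Ξ D a v) (by
          rw [le_principal_iff]
          change ∀ᶠ D in (U : Filter (Finset ℝ)), gridSum Ξ D a v ∈ Metric.closedBall _ _
          filter_upwards [hev a, hev v] with D ha hvD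
          rw [mem_closedBall_iff_norm]
          exact norm_gridSum_sub_le hV₀ hθ₀ zero_le_one hΞ0 (by simpa using hΞ) D a v ha hvD
            le_rfl hv.1 hv.2)
      exact ⟨y, fun _ _ => hy⟩
    · exact ⟨0, fun h1 h2 => absurd ⟨h1, h2⟩ hv⟩
  choose J hJ using hlim
  refine ⟨J, fun s t V θ c hs hst ht hV hθ hc hloc => ?_⟩
  refine le_of_tendsto (((hJ t (hs.trans hst) ht).sub (hJ s hs (hst.trans ht))).sub_const
    (Ξ s t)).norm ?_
  filter_upwards [hev s, hev t] with D hsD htD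
  rw [← gridSum_add Ξ D hs hst, add_sub_cancel_left]
  exact norm_gridSum_sub_le hV hθ hc hΞ0 hloc D s t hsD htD le_rfl hst le_rfl

end Sewing

section Sharpen

variable {F : Type*} [NormedAddCommGroup F]

lemma norm_sewing_le_step {J : ℝ → F} {Ξ : ℝ → ℝ → F} {V : ℝ → ℝ → ℝ} {s t θ C : ℝ}
    (hst : s ≤ t) (hV : IsSuperadditiveOn s t V) (hθ : 1 < θ) (hC : 0 ≤ C)
    (hJ : ContinuousOn J (Icc s t))
    (hΞc : ContinuousOn (fun pr : ℝ × ℝ => Ξ pr.1 pr.2) (Icc s t ×ˢ Icc s t))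
    (hΞ0 : ∀ u, Ξ u u = 0)
    (hΞ : ∀ u v w, s ≤ u → u ≤ v → v ≤ w → w ≤ t →
      ‖Ξ u w - Ξ u v - Ξ v w‖ ≤ V u w ^ θ)
    (hb : ∀ u v, s ≤ u → u ≤ v → v ≤ t → ‖J v - J u - Ξ u v‖ ≤ C * V u v ^ θ) :
    ‖J t - J s - Ξ s t‖ ≤ (C * (2:ℝ) ^ (1 - θ) + 1) * V s t ^ θ := by
  have hVst := hV.nonneg s t le_rfl hst le_rfl
  set S := {u : ℝ | u ∈ Icc s t ∧ V s u ≤ V s t / 2} with hS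
  have hsS : s ∈ S := ⟨⟨le_rfl, hst⟩, by rw [hV.self_eq_zero le_rfl hst]; linarith⟩
  have hSb : BddAbove S := ⟨t, fun u hu => hu.1.2⟩
  set m := sSup S with hm
  have hsm : s ≤ m := le_csSup hSb hsS
  have hmt : m ≤ t := csSup_le ⟨s, hsS⟩ fun u hu => hu.1.2
  let R : ℝ × ℝ → ℝ := fun pr => ‖J pr.2 - J pr.1 - Ξ pr.1 pr.2‖ +
    ‖Ξ pr.1 t - Ξ pr.1 pr.2 - Ξ pr.2 t‖
  have hRc : ContinuousOn R (Icc s t ×ˢ Icc s t) := by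
    have h1 : ContinuousOn (fun pr : ℝ × ℝ => J pr.1) (Icc s t ×ˢ Icc s t) :=
      hJ.comp continuousOn_fst fun pr hpr => hpr.1
    have h2 : ContinuousOn (fun pr : ℝ × ℝ => J pr.2) (Icc s t ×ˢ Icc s t) :=
      hJ.comp continuousOn_snd fun pr hpr => hpr.2
    have h3 : ContinuousOn (fun pr : ℝ × ℝ => Ξ pr.1 t) (Icc s t ×ˢ Icc s t) :=
      hΞc.comp (f := fun pr : ℝ × ℝ => (pr.1, t)) (by fun_prop)
        fun pr hpr => ⟨hpr.1, hst, le_rfl⟩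
    have h4 : ContinuousOn (fun pr : ℝ × ℝ => Ξ pr.2 t) (Icc s t ×ˢ Icc s t) :=
      hΞc.comp (f := fun pr : ℝ × ℝ => (pr.2, t)) (by fun_prop)
        fun pr hpr => ⟨hpr.2, hst, le_rfl⟩
    exact ((h2.sub h1).sub hΞc).norm.add ((h3.sub hΞc).sub h4).norm
  have hR0 : R (m, m) = 0 := by simp [R, hΞ0]
  refine le_of_forall_pos_le_add fun ε hε => ?_
  obtain ⟨η, hη, hηR⟩ := Metric.continuousOn_iff.1 hRc (m, m) ⟨⟨hsm, hmt⟩, hsm, hmt⟩ ε hε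
  obtain ⟨u, huS, hu⟩ := exists_lt_of_lt_csSup ⟨s, hsS⟩ (show m - η < sSup S by linarith)
  have hum : u ≤ m := le_csSup hSb huS
  set v := min t (m + η / 2) with hv
  have hmv : m ≤ v := le_min hmt (by linarith)
  have hvt : v ≤ t := min_le_left _ _
  have huv := hum.trans hmv
  have hVv : V v t ≤ V s t / 2 := by
    rcases hvt.eq_or_lt with h | h
    · rw [h, hV.self_eq_zero hst le_rfl]
      linarith
    · have hv' : v = m + η / 2 := by
        rcases min_choice t (m + η / 2) with h' | h'
        · exact absurd h' h.ne
        · exact h'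
      have h1 : ¬ V s v ≤ V s t / 2 := fun hcon => by
        have := le_csSup hSb (show v ∈ S from ⟨⟨hsm.trans hmv, hvt⟩, hcon⟩)
        linarith
      have := hV.add_le s v t le_rfl (hsm.trans hmv) hvt le_rfl
      linarith [not_le.1 h1]
  have hRuv : R (u, v) < ε := by
    have := hηR (u, v) ⟨huS.1, hsm.trans hmv, hvt⟩ (by
      rw [Prod.dist_eq, max_lt_iff, Real.dist_eq, Real.dist_eq, abs_lt, abs_lt]
      have : v ≤ m + η / 2 := min_le_right _ _
      refine ⟨⟨?_, ?_⟩, ?_, ?_⟩ <;> simp only <;> linarith)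
    rw [hR0, Real.dist_eq, sub_zero] at this
    exact (abs_lt.1 this).2
  have b1 := hb s u le_rfl huS.1.1 huS.1.2
  have b2 := hb v t (hsm.trans hmv) hvt le_rfl
  have d1 := hΞ s u t le_rfl huS.1.1 huS.1.2 le_rfl
  have e1 : V s u ^ θ ≤ (V s t / 2) ^ θ :=
    Real.rpow_le_rpow (hV.nonneg s u le_rfl huS.1.1 huS.1.2) huS.2 (by linarith)
  have e2 : V v t ^ θ ≤ (V s t / 2) ^ θ :=
    Real.rpow_le_rpow (hV.nonneg v t (hsm.trans hmv) hvt le_rfl) hVv (by linarith)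
  have hsplit : J t - J s - Ξ s t = (J u - J s - Ξ s u) + (J t - J v - Ξ v t) -
      (Ξ s t - Ξ s u - Ξ u t) + ((J v - J u - Ξ u v) - (Ξ u t - Ξ u v - Ξ v t)) := by abel
  have htri : ‖J t - J s - Ξ s t‖ ≤ ‖J u - J s - Ξ s u‖ + ‖J t - J v - Ξ v t‖ +
      ‖Ξ s t - Ξ s u - Ξ u t‖ + R (u, v) := by
    rw [hsplit]
    exact (norm_add_le _ _).trans (add_le_add ((norm_sub_le _ _).trans
      (add_le_add_left (norm_add_le _ _) _)) (norm_sub_le _ _))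
  have hhalf := two_mul_half_rpow (θ := θ) hVst
  have m1 := mul_le_mul_of_nonneg_left e1 hC
  have m2 := mul_le_mul_of_nonneg_left e2 hC
  calc _ ≤ C * (2 * (V s t / 2) ^ θ) + V s t ^ θ + ε := by linarith
    _ = _ := by rw [hhalf]; ring

open Filter Topology in
lemma norm_sewing_le {J : ℝ → F} {Ξ : ℝ → ℝ → F} {V : ℝ → ℝ → ℝ} {a b θ C : ℝ}
    (hV : IsSuperadditiveOn a b V) (hθ : 1 < θ) (hC : 0 ≤ C)
    (hJ : ContinuousOn J (Icc a b))
    (hΞc : ContinuousOn (fun pr : ℝ × ℝ => Ξ pr.1 pr.2) (Icc a b ×ˢ Icc a b))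
    (hΞ0 : ∀ u, Ξ u u = 0)
    (hΞ : ∀ u v w, a ≤ u → u ≤ v → v ≤ w → w ≤ b →
      ‖Ξ u w - Ξ u v - Ξ v w‖ ≤ V u w ^ θ)
    (hb : ∀ u v, a ≤ u → u ≤ v → v ≤ b → ‖J v - J u - Ξ u v‖ ≤ C * V u v ^ θ)
    {s t : ℝ} (hs : a ≤ s) (hst : s ≤ t) (ht : t ≤ b) :
    ‖J t - J s - Ξ s t‖ ≤ (1 - (2:ℝ) ^ (1 - θ))⁻¹ * V s t ^ θ := by
  set l := (2:ℝ) ^ (1 - θ) with hl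
  set K := (1 - l)⁻¹ with hK
  have hl1 : l < 1 := two_rpow_one_sub_lt_one hθ
  have hl0 : 0 ≤ l := by positivity
  have hK0 : 0 < K := inv_pos.2 (by linarith)
  have hKeq : K * l + 1 = K := by
    have : K * (1 - l) = 1 := inv_mul_cancel₀ (by linarith)
    linarith
  have hiter : ∀ n : ℕ, ∀ u v, a ≤ u → u ≤ v → v ≤ b →
      ‖J v - J u - Ξ u v‖ ≤ (K + l ^ n * C) * V u v ^ θ := by
    intro n
    induction n with
    | zero =>
      intro u v h1 h2 h3
      have := Real.rpow_nonneg (hV.nonneg u v h1 h2 h3) θ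
      refine (hb u v h1 h2 h3).trans (mul_le_mul_of_nonneg_right ?_ this)
      rw [pow_zero]
      linarith
    | succ n ih =>
      intro u v h1 h2 h3
      have hsub : Icc u v ⊆ Icc a b := Icc_subset_Icc h1 h3
      refine (norm_sewing_le_step h2 (hV.mono_Icc h1 h3) hθ
        (show 0 ≤ K + l ^ n * C by positivity) (hJ.mono hsub)
        (hΞc.mono (Set.prod_mono hsub hsub)) hΞ0
        (fun x y z k1 k2 k3 k4 => hΞ x y z (h1.trans k1) k2 k3 (k4.trans h3))
        (fun x y k1 k2 k3 => ih x y (h1.trans k1) k2 (k3.trans h3))).trans_eq ?_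
      rw [← hl, pow_succ]
      linear_combination V u v ^ θ * hKeq
  have hlim : Tendsto (fun n : ℕ => (K + l ^ n * C) * V s t ^ θ) atTop
      (𝓝 ((K + 0 * C) * V s t ^ θ)) :=
    ((tendsto_const_nhds.add ((tendsto_pow_atTop_nhds_zero_of_lt_one hl0 hl1).mul_const C)).mul_const
      _)
  have := ge_of_tendsto' hlim fun n => hiter n s t hs hst ht
  simpa using this

end Sharpen

lemma exists_nat_partition {n : ℕ} {t : Fin (n + 1) → ℝ} (ht : StrictMono t) :
    ∃ τ : ℕ → ℝ, (∀ i < n, τ i < τ (i + 1)) ∧ τ 0 = t 0 ∧ τ n = t (Fin.last n) ∧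
      ∀ i : Fin n, τ i = t i.castSucc ∧ τ (i + 1) = t i.succ := by
  refine ⟨fun i => if h : i < n + 1 then t ⟨i, h⟩ else 0, fun i hi => ?_, ?_, ?_, fun i => ?_⟩
  · have h1 : i < n + 1 := by omega
    have h2 : i + 1 < n + 1 := by omega
    simp only [h1, h2, dif_pos]
    exact ht (by simp [Fin.lt_def])
  · simp
  · simp [Fin.last]
  · have h1 : (i : ℕ) < n + 1 := by omega
    have h2 : (i : ℕ) + 1 < n + 1 := by omega
    simp only [h1, h2, dif_pos]
    exact ⟨rfl, rfl⟩

section PVar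

variable {E : Type*} [NormedAddCommGroup E]

lemma mem_pVarSums_iff {p : ℝ} {x : ℝ → E} {a b v : ℝ} :
    v ∈ pVarSums p x a b ↔ ∃ (n : ℕ) (τ : ℕ → ℝ), (∀ i < n, τ i < τ (i + 1)) ∧ τ 0 = a ∧
      τ n = b ∧ v = ∑ i ∈ Finset.range n, ‖x (τ (i + 1)) - x (τ i)‖ ^ p := by
  constructor
  · rintro ⟨n, t, ht, h0, hn, rfl⟩
    obtain ⟨τ, h1, h2, h3, h4⟩ := exists_nat_partition ht
    refine ⟨n, τ, h1, h2.trans h0, h3.trans hn, ?_⟩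
    rw [Finset.sum_range]
    exact Finset.sum_congr rfl fun i _ => by rw [(h4 i).1, (h4 i).2]
  · rintro ⟨n, τ, h1, h2, h3, rfl⟩
    refine ⟨n, fun i => τ i, Fin.strictMono_iff_lt_succ.2 fun i => ?_, by simpa using h2,
      by simpa using h3, ?_⟩
    · simpa using h1 i i.2
    · rw [Finset.sum_range]
      simp

lemma pVarSums_nonempty (p : ℝ) (x : ℝ → E) {a b : ℝ} (hab : a ≤ b) :
    (pVarSums p x a b).Nonempty := by
  rcases hab.eq_or_lt with rfl | h
  · exact ⟨_, mem_pVarSums_iff.2 ⟨0, fun _ => a, by simp, rfl, rfl, rfl⟩⟩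
  · exact ⟨_, mem_pVarSums_iff.2 ⟨1, fun i => if i = 0 then a else b, by simpa using h, by simp,
      by simp, rfl⟩⟩

lemma nonneg_of_mem_pVarSums {p : ℝ} {x : ℝ → E} {a b v : ℝ} (hv : v ∈ pVarSums p x a b) :
    0 ≤ v := by
  obtain ⟨n, t, -, -, -, rfl⟩ := hv
  exact Finset.sum_nonneg fun i _ => Real.rpow_nonneg (norm_nonneg _) _

lemma add_mem_pVarSums {p : ℝ} {x : ℝ → E} {a b c v w : ℝ} (hv : v ∈ pVarSums p x a b)
    (hw : w ∈ pVarSums p x b c) : v + w ∈ pVarSums p x a c := by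
  obtain ⟨n, τ, h1, h2, h3, rfl⟩ := mem_pVarSums_iff.1 hv
  obtain ⟨k, σ, k1, k2, k3, rfl⟩ := mem_pVarSums_iff.1 hw
  let ρ : ℕ → ℝ := fun i => if i ≤ n then τ i else σ (i - n)
  have hρ1 : ∀ i ≤ n, ρ i = τ i := fun i hi => if_pos hi
  have hρ2 : ∀ i, ρ (n + i) = σ i := by
    intro i
    rcases Nat.eq_zero_or_pos i with rfl | hi
    · simp [ρ, h3, k2]
    · have : ¬ n + i ≤ n := by omega
      simp [ρ, this]
  refine mem_pVarSums_iff.2 ⟨n + k, ρ, fun i hi => ?_, ?_, ?_, ?_⟩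
  · rcases lt_or_ge i n with h | h
    · rw [hρ1 i h.le, hρ1 (i + 1) h]
      exact h1 i h
    · obtain ⟨j, rfl⟩ := Nat.exists_eq_add_of_le h
      rw [add_assoc, hρ2, hρ2]
      exact k1 j (by omega)
  · rw [hρ1 0 (Nat.zero_le _), h2]
  · rw [hρ2, k3]
  · rw [Finset.sum_range_add]
    congr 1
    · refine Finset.sum_congr rfl fun i hi => ?_
      have := Finset.mem_range.1 hi
      rw [hρ1 i this.le, hρ1 (i + 1) this]
    · refine Finset.sum_congr rfl fun i _ => ?_
      rw [add_assoc, hρ2, hρ2]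

lemma FinitePVar.mono {p : ℝ} {x : ℝ → E} {a b s t : ℝ} (hx : FinitePVar p x a b)
    (hs : a ≤ s) (ht : t ≤ b) : FinitePVar p x s t := by
  obtain ⟨C, hC⟩ := hx
  refine ⟨C, fun v hv => ?_⟩
  obtain ⟨u, hu⟩ := pVarSums_nonempty p x hs
  obtain ⟨w, hw⟩ := pVarSums_nonempty p x ht
  have := hC (add_mem_pVarSums (add_mem_pVarSums hu hv) hw)
  linarith [nonneg_of_mem_pVarSums hu, nonneg_of_mem_pVarSums hw]

lemma FinitePVar.isSuperadditiveOn {p : ℝ} {x : ℝ → E} {a b : ℝ} (hx : FinitePVar p x a b) :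
    IsSuperadditiveOn a b (fun s t => sSup (pVarSums p x s t)) where
  nonneg s t _ _ _ := Real.sSup_nonneg fun _ hv => nonneg_of_mem_pVarSums hv
  add_le s t u h1 h2 h3 h4 := by
    have n1 := pVarSums_nonempty p x h2
    have n2 := pVarSums_nonempty p x h3
    rw [← le_sub_iff_add_le]
    refine csSup_le n1 fun v hv => ?_
    rw [le_sub_iff_add_le, ← le_sub_iff_add_le']
    refine csSup_le n2 fun w hw => ?_
    rw [le_sub_iff_add_le']
    exact le_csSup (hx.mono h1 h4) (add_mem_pVarSums hv hw)

lemma FinitePVar.norm_sub_le {p : ℝ} {x : ℝ → E} {a b s t : ℝ} (hx : FinitePVar p x a b)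
    (hp : 0 < p) (hs : a ≤ s) (hst : s ≤ t) (ht : t ≤ b) : ‖x t - x s‖ ≤ pVar p x s t := by
  have hpow : ‖x t - x s‖ ^ p ≤ sSup (pVarSums p x s t) := by
    rcases hst.eq_or_lt with rfl | h
    · rw [sub_self, norm_zero, Real.zero_rpow hp.ne']
      exact hx.isSuperadditiveOn.nonneg s s hs hst ht
    · refine le_csSup (hx.mono hs ht) (mem_pVarSums_iff.2
        ⟨1, fun i => if i = 0 then s else t, by simpa using h, by simp, by simp, by simp⟩)
  have := Real.rpow_le_rpow (by positivity) hpow (show 0 ≤ 1 / p by positivity)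
  rwa [← Real.rpow_mul (norm_nonneg _), mul_one_div_cancel hp.ne', Real.rpow_one] at this

lemma pVarSums_le_of_norm_sub_le {q : ℝ} {z : ℝ → E} {a b γ₁ γ₂ c₁ c₂ : ℝ}
    {W₁ W₂ : ℝ → ℝ → ℝ} (hq : 1 ≤ q) (hW₁ : IsSuperadditiveOn a b W₁)
    (hW₂ : IsSuperadditiveOn a b W₂) (hγ₁ : 1 ≤ γ₁ * q) (hγ₂ : 1 ≤ γ₂ * q)
    (hc₁ : 0 ≤ c₁) (hc₂ : 0 ≤ c₂)
    (hz : ∀ u v, a ≤ u → u ≤ v → v ≤ b →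
      ‖z v - z u‖ ≤ c₁ * W₁ u v ^ γ₁ + c₂ * W₂ u v ^ γ₂)
    {s t : ℝ} (hs : a ≤ s) (hst : s ≤ t) (ht : t ≤ b) :
    ∀ v ∈ pVarSums q z s t, v ≤ (c₁ * W₁ s t ^ γ₁ + c₂ * W₂ s t ^ γ₂) ^ q := by
  intro v hv
  obtain ⟨n, τ, hτ, h0, hn, rfl⟩ := mem_pVarSums_iff.1 hv
  have hq0 : 0 < q := by linarith
  have hpart : ∀ i < n, s ≤ τ i ∧ τ (i + 1) ≤ t := by
    have hmono : ∀ i j, i ≤ j → j ≤ n → τ i ≤ τ j := by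
      intro i j hij
      induction j, hij using Nat.le_induction with
      | base => intro _; exact le_rfl
      | succ j _ ih => intro hj; exact (ih (by omega)).trans (hτ j (by omega)).le
    intro i hi
    exact ⟨h0 ▸ hmono 0 i (Nat.zero_le _) hi.le, hn ▸ hmono (i + 1) n hi le_rfl⟩
  have aux : ∀ {W : ℝ → ℝ → ℝ} {γ c : ℝ}, IsSuperadditiveOn a b W → 1 ≤ γ * q → 0 ≤ c →
      (∀ i ∈ Finset.range n, 0 ≤ c * W (τ i) (τ (i + 1)) ^ γ) ∧
      (∑ i ∈ Finset.range n, (c * W (τ i) (τ (i + 1)) ^ γ) ^ q) ^ (1 / q) ≤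
        c * W s t ^ γ := by
    intro W γ c hW hγ hc
    have hW0 : ∀ i ∈ Finset.range n, 0 ≤ W (τ i) (τ (i + 1)) := fun i hi => by
      have hi' := Finset.mem_range.1 hi
      exact hW.nonneg _ _ (hs.trans (hpart i hi').1) (hτ i hi').le ((hpart i hi').2.trans ht)
    have hnn : ∀ i ∈ Finset.range n, 0 ≤ c * W (τ i) (τ (i + 1)) ^ γ :=
      fun i hi => mul_nonneg hc (Real.rpow_nonneg (hW0 i hi) _)
    refine ⟨hnn, ?_⟩
    have hst0 := hW.nonneg s t hs hst ht
    have hexp : ∀ w : ℝ, 0 ≤ w → (c * w ^ γ) ^ q = c ^ q * w ^ (γ * q) := fun w hw => by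
      rw [Real.mul_rpow hc (Real.rpow_nonneg hw _), Real.rpow_mul hw]
    have hsum := ((hW.rpow hγ).sum_le τ n (fun i hi => (hτ i hi).le) (h0 ▸ hs)
      (hn ▸ ht)).2
    rw [h0, hn] at hsum
    have hle : ∑ i ∈ Finset.range n, (c * W (τ i) (τ (i + 1)) ^ γ) ^ q ≤
        (c * W s t ^ γ) ^ q := by
      rw [hexp _ hst0, Finset.sum_congr rfl fun i hi => hexp _ (hW0 i hi), ← Finset.mul_sum]
      exact mul_le_mul_of_nonneg_left hsum (Real.rpow_nonneg hc _)
    have := Real.rpow_le_rpow (Finset.sum_nonneg fun i hi => Real.rpow_nonneg (hnn i hi) _) hle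
      (show 0 ≤ 1 / q by positivity)
    rwa [← Real.rpow_mul (mul_nonneg hc (Real.rpow_nonneg hst0 _)), mul_one_div_cancel hq0.ne',
      Real.rpow_one] at this
  obtain ⟨f0, f1⟩ := aux hW₁ hγ₁ hc₁
  obtain ⟨g0, g1⟩ := aux hW₂ hγ₂ hc₂
  have hmink := Real.Lp_add_le_of_nonneg (Finset.range n) hq f0 g0
  have hsum0 : 0 ≤ ∑ i ∈ Finset.range n,
      (c₁ * W₁ (τ i) (τ (i + 1)) ^ γ₁ + c₂ * W₂ (τ i) (τ (i + 1)) ^ γ₂) ^ q :=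
    Finset.sum_nonneg fun i hi => Real.rpow_nonneg (add_nonneg (f0 i hi) (g0 i hi)) _
  have hpow := Real.rpow_le_rpow (Real.rpow_nonneg hsum0 _) (hmink.trans (add_le_add f1 g1))
    hq0.le
  rw [← Real.rpow_mul hsum0, one_div_mul_cancel hq0.ne', Real.rpow_one] at hpow
  refine (Finset.sum_le_sum fun i hi => ?_).trans hpow
  have hi' := Finset.mem_range.1 hi
  exact Real.rpow_le_rpow (norm_nonneg _) (hz _ _ (hs.trans (hpart i hi').1) (hτ i hi').le
    ((hpart i hi').2.trans ht)) hq0.le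

lemma pVar_le_of_forall_le {q C : ℝ} {z : ℝ → E} {s t : ℝ} (hq : 0 < q) (hst : s ≤ t)
    (hC : 0 ≤ C) (h : ∀ v ∈ pVarSums q z s t, v ≤ C ^ q) : pVar q z s t ≤ C := by
  have := Real.rpow_le_rpow (Real.sSup_nonneg fun _ hv => nonneg_of_mem_pVarSums hv)
    (csSup_le (pVarSums_nonempty q z hst) h) (show 0 ≤ 1 / q by positivity)
  rwa [← Real.rpow_mul hC, mul_one_div_cancel hq.ne', Real.rpow_one] at this

end PVar

section Young

variable {E F : Type*} [NormedAddCommGroup E] [NormedSpace ℝ E]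
  [NormedAddCommGroup F] [NormedSpace ℝ F]

lemma rpow_div_mul_rpow_div_rpow {A B r ρ θ : ℝ} (hA : 0 ≤ A) (hB : 0 ≤ B) (hθ : θ ≠ 0) :
    (A ^ (r / θ) * B ^ (ρ / θ)) ^ θ = A ^ r * B ^ ρ := by
  rw [Real.mul_rpow (Real.rpow_nonneg hA _) (Real.rpow_nonneg hB _), ← Real.rpow_mul hA,
    ← Real.rpow_mul hB, div_mul_cancel₀ _ hθ, div_mul_cancel₀ _ hθ]

lemma IsSuperadditiveOn.rpow_div_mul_rpow_div {a b r ρ : ℝ} {A B : ℝ → ℝ → ℝ}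
    (hA : IsSuperadditiveOn a b A) (hB : IsSuperadditiveOn a b B) (hr : 0 < r) (hρ : 0 < ρ) :
    IsSuperadditiveOn a b (fun s t => A s t ^ (r / (ρ + r)) * B s t ^ (ρ / (ρ + r))) :=
  hA.rpow_mul_rpow hB (by positivity) (by positivity) (by field_simp; ring)

lemma TaggedPartition.sub_lt_of_mesh_lt {a b δ : ℝ} {P : TaggedPartition a b}
    (hP : P.mesh < δ) (i : Fin P.n) : P.t i.succ - P.t i.castSucc < δ :=
  (le_ciSup (f := fun i : Fin P.n => P.t i.succ - P.t i.castSucc)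
    (Set.finite_range _).bddAbove i).trans_lt hP

lemma exists_taggedPartition_mesh_lt {a b δ : ℝ} (hab : a ≤ b) (hδ : 0 < δ) :
    ∃ P : TaggedPartition a b, P.mesh < δ := by
  rcases hab.eq_or_lt with rfl | h
  · refine ⟨⟨0, fun _ => a, fun i => i.elim0, fun i j hij => ?_, rfl, rfl, fun i => i.elim0⟩, ?_⟩
    · exact absurd (Fin.ext (by omega)) hij.ne
    · simpa [TaggedPartition.mesh] using hδ
  · obtain ⟨n, hn⟩ := exists_nat_gt ((b - a) / δ)
    have hn0 : (0:ℝ) < n := (div_pos (sub_pos.2 h) hδ).trans hn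
    have hstep : 0 < (b - a) / n := div_pos (sub_pos.2 h) hn0
    have hsucc : ∀ i : Fin n, a + (i.succ : Fin (n + 1)) * ((b - a) / n) -
        (a + (i.castSucc : Fin (n + 1)) * ((b - a) / n)) = (b - a) / n := fun i => by
      simp only [Fin.val_succ, Fin.val_castSucc]
      push_cast
      ring
    refine ⟨⟨n, fun i => a + (i : ℕ) * ((b - a) / n), fun i => a + (i : ℕ) * ((b - a) / n),
      Fin.strictMono_iff_lt_succ.2 fun i => ?_, by simp, ?_, fun i => ⟨by simp, ?_⟩⟩, ?_⟩
    · linarith [hsucc i]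
    · simp only [Fin.val_last]
      field_simp
      ring
    · have := hsucc i
      simp only [Fin.val_castSucc] at this
      linarith
    · have : Nonempty (Fin n) := ⟨⟨0, by exact_mod_cast hn0⟩⟩
      refine (ciSup_le fun i => (hsucc i).le).trans_lt ?_
      rw [div_lt_iff₀ hδ] at hn
      rw [div_lt_iff₀ hn0]
      linarith

lemma IsYoungIntegral.unique {y : ℝ → E →L[ℝ] F} {ω : ℝ → E} {a b : ℝ} {v w : F} (hab : a ≤ b)
    (hv : IsYoungIntegral y ω a b v) (hw : IsYoungIntegral y ω a b w) : v = w := by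
  by_contra hne
  have hpos : 0 < ‖v - w‖ / 2 := half_pos (norm_pos_iff.2 (sub_ne_zero.2 hne))
  obtain ⟨δ₁, h1, k1⟩ := hv _ hpos
  obtain ⟨δ₂, h2, k2⟩ := hw _ hpos
  obtain ⟨P, hP⟩ := exists_taggedPartition_mesh_lt hab (lt_min h1 h2)
  have l1 := k1 P (hP.trans_le (min_le_left _ _))
  have l2 := k2 P (hP.trans_le (min_le_right _ _))
  have : ‖v - w‖ ≤ ‖RSSum y ω P - w‖ + ‖RSSum y ω P - v‖ := by
    rw [show v - w = (RSSum y ω P - w) - (RSSum y ω P - v) by abel]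
    exact norm_sub_le _ _
  linarith

lemma IsYoungIntegral.youngIntegral_eq {y : ℝ → E →L[ℝ] F} {ω : ℝ → E} {a b : ℝ} {v : F}
    (hab : a ≤ b) (hv : IsYoungIntegral y ω a b v) : youngIntegral y ω a b = v := by
  have hex : ∃ v, IsYoungIntegral y ω a b v := ⟨v, hv⟩
  unfold youngIntegral
  rw [dif_pos hex]
  exact hex.choose_spec.unique hab hv

/-- Existence of the Young integral together with the Young–Loève estimate. -/
theorem exists_young_integral [ProperSpace F] {y : ℝ → E →L[ℝ] F} {ω : ℝ → E} {a b r ρ : ℝ}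
    {A B : ℝ → ℝ → ℝ} (hab : a ≤ b) (hA : IsSuperadditiveOn a b A)
    (hB : IsSuperadditiveOn a b B)
    (hr : 0 < r) (hρ : 0 < ρ) (hθ : 1 < ρ + r)
    (hyc : ContinuousOn y (Icc a b)) (hωc : ContinuousOn ω (Icc a b))
    (hyA : ∀ u v, a ≤ u → u ≤ v → v ≤ b → ‖y v - y u‖ ≤ A u v ^ r)
    (hωB : ∀ u v, a ≤ u → u ≤ v → v ≤ b → ‖ω v - ω u‖ ≤ B u v ^ ρ) :
    ∃ J : ℝ → F, ContinuousOn J (Icc a b) ∧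
      (∀ t ∈ Icc a b, IsYoungIntegral y ω a t (J t - J a)) ∧
      ∀ s t, a ≤ s → s ≤ t → t ≤ b → ‖J t - J s - y s (ω t - ω s)‖ ≤
        (1 - (2:ℝ) ^ (1 - (ρ + r)))⁻¹ * (A s t ^ r * B s t ^ ρ) := by
  let Ξ : ℝ → ℝ → F := fun u v => y u (ω v - ω u)
  have hΞ0 : ∀ u, Ξ u u = 0 := fun u => by simp [Ξ]
  have hdef : ∀ u v w, ‖Ξ u w - Ξ u v - Ξ v w‖ ≤ ‖y v - y u‖ * ‖ω w - ω v‖ := by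
    intro u v w
    have : Ξ u w - Ξ u v - Ξ v w = -((y v - y u) (ω w - ω v)) := by
      simp only [Ξ, map_sub, sub_apply]
      abel
    rw [this, norm_neg]
    exact (y v - y u).le_opNorm _
  have hpow : ∀ {σ : ℝ}, 0 < σ → ∀ u v, a ≤ u → u ≤ v → v ≤ b →
      (A u v ^ (r / (σ + r)) * B u v ^ (σ / (σ + r))) ^ (σ + r) = A u v ^ r * B u v ^ σ :=
    fun hσ u v h1 h2 h3 => rpow_div_mul_rpow_div_rpow (hA.nonneg u v h1 h2 h3)
      (hB.nonneg u v h1 h2 h3) (by positivity)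
  have hAmono : ∀ u v w, a ≤ u → u ≤ v → v ≤ w → w ≤ b → A u v ^ r ≤ A u w ^ r :=
    fun u v w h1 h2 h3 h4 => Real.rpow_le_rpow (hA.nonneg u v h1 h2 (h3.trans h4))
      (hA.mono h1 le_rfl h2 h3 h4) hr.le
  have hBmono : ∀ {σ : ℝ}, 0 < σ → ∀ u v w, a ≤ u → u ≤ v → v ≤ w → w ≤ b →
      B v w ^ σ ≤ B u w ^ σ :=
    fun hσ u v w h1 h2 h3 h4 => Real.rpow_le_rpow (hB.nonneg v w (h1.trans h2) h3 h4)
      (hB.mono h1 h2 h3 le_rfl h4) hσ.le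
  have hA0 : ∀ u v, a ≤ u → u ≤ v → v ≤ b → 0 ≤ A u v ^ r :=
    fun u v h1 h2 h3 => Real.rpow_nonneg (hA.nonneg u v h1 h2 h3) _
  have hB0 : ∀ (σ : ℝ) u v, a ≤ u → u ≤ v → v ≤ b → 0 ≤ B u v ^ σ :=
    fun σ u v h1 h2 h3 => Real.rpow_nonneg (hB.nonneg u v h1 h2 h3) _
  have hΞ : ∀ u v w, a ≤ u → u ≤ v → v ≤ w → w ≤ b → ‖Ξ u w - Ξ u v - Ξ v w‖ ≤
      (A u w ^ (r / (ρ + r)) * B u w ^ (ρ / (ρ + r))) ^ (ρ + r) := by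
    intro u v w h1 h2 h3 h4
    rw [hpow hρ u w h1 (h2.trans h3) h4]
    exact (hdef u v w).trans (mul_le_mul
      ((hyA u v h1 h2 (h3.trans h4)).trans (hAmono u v w h1 h2 h3 h4))
      ((hωB v w (h1.trans h2) h3 h4).trans (hBmono hρ u v w h1 h2 h3 h4)) (norm_nonneg _)
      (hA0 u w h1 (h2.trans h3) h4))
  have hV := hA.rpow_div_mul_rpow_div hB hr hρ
  obtain ⟨J, hJ⟩ := exists_sewing hV hθ hΞ0 hΞ
  -- A smaller exponent for `ω` gains a factor which is small with the mesh.
  obtain ⟨σ, hσ1, hσρ⟩ := exists_between (max_lt (show 1 - r < ρ by linarith) hρ)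
  have hσ0 : 0 < σ := (le_max_right _ _).trans_lt hσ1
  have hσr : 1 < σ + r := by linarith [(le_max_left (1 - r) 0).trans_lt hσ1]
  have hV' := hA.rpow_div_mul_rpow_div hB hr hσ0
  set K' := (1 - (2:ℝ) ^ (1 - (σ + r)))⁻¹ with hK'
  have hK'0 : 0 < K' := inv_pos.2 (by linarith [two_rpow_one_sub_lt_one hσr])
  have hωu := Metric.uniformContinuousOn_iff.1
    (isCompact_Icc.uniformContinuousOn_of_continuous hωc)
  have hκ : 0 < 1 - σ / ρ := by
    rw [sub_pos, div_lt_one hρ]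
    exact hσρ
  have hsmall : ∀ ε > 0, ∃ d > 0, ∀ u v, a ≤ u → u ≤ v → v ≤ b → v - u < d →
      ‖ω v - ω u‖ ≤ ε * B u v ^ σ := by
    intro ε hε
    obtain ⟨d, hd, hd'⟩ := hωu (ε ^ (1 - σ / ρ)⁻¹) (by positivity)
    refine ⟨d, hd, fun u v h1 h2 h3 h4 => ?_⟩
    have hlt := hd' u ⟨h1, h2.trans h3⟩ v ⟨h1.trans h2, h3⟩ (by
      rw [dist_comm, Real.dist_eq, abs_lt]
      constructor <;> linarith)
    rw [dist_comm, dist_eq_norm] at hlt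
    have e1 : ‖ω v - ω u‖ ^ (1 - σ / ρ) ≤ ε := by
      have := Real.rpow_le_rpow (norm_nonneg _) hlt.le hκ.le
      rwa [← Real.rpow_mul hε.le, inv_mul_cancel₀ hκ.ne', Real.rpow_one] at this
    have e2 : ‖ω v - ω u‖ ^ (σ / ρ) ≤ B u v ^ σ := by
      have := Real.rpow_le_rpow (norm_nonneg _) (hωB u v h1 h2 h3)
        (show 0 ≤ σ / ρ by positivity)
      rwa [← Real.rpow_mul (hB.nonneg u v h1 h2 h3), mul_div_cancel₀ _ hρ.ne'] at this
    have e3 : ‖ω v - ω u‖ = ‖ω v - ω u‖ ^ (1 - σ / ρ) * ‖ω v - ω u‖ ^ (σ / ρ) := by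
      rw [← Real.rpow_add_of_nonneg (norm_nonneg _) hκ.le (by positivity), sub_add_cancel,
        Real.rpow_one]
    rw [e3]
    exact mul_le_mul e1 e2 (by positivity) hε.le
  have hlocal : ∀ ε > 0, ∃ d > 0, ∀ s t, a ≤ s → s ≤ t → t ≤ b → t - s < d → ∀ ξ ∈ Icc s t,
      ‖J t - J s - y ξ (ω t - ω s)‖ ≤ ε * (A s t ^ r * B s t ^ σ) := by
    intro ε hε
    obtain ⟨d, hd, hd'⟩ := hsmall (ε / (2 * K' + 1)) (by positivity)
    refine ⟨d, hd, fun s t hs hst ht htd ξ hξ => ?_⟩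
    set c := ε / (2 * K' + 1) with hc
    have hc0 : 0 < c := by positivity
    have h1 := hJ s t _ (σ + r) c hs hst ht (hV'.mono_Icc hs ht) hσr hc0.le (by
      intro u v w h1 h2 h3 h4
      rw [hpow hσ0 u w (hs.trans h1) (h2.trans h3) (h4.trans ht)]
      have e1 := (hyA u v (hs.trans h1) h2 ((h3.trans h4).trans ht)).trans
        (hAmono u v w (hs.trans h1) h2 h3 (h4.trans ht))
      have e2 := (hd' v w ((hs.trans h1).trans h2) h3 (h4.trans ht) (by linarith)).trans
        (mul_le_mul_of_nonneg_left (hBmono hσ0 u v w (hs.trans h1) h2 h3 (h4.trans ht)) hc0.le)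
      refine (hdef u v w).trans ((mul_le_mul e1 e2 (norm_nonneg _)
        (hA0 u w (hs.trans h1) (h2.trans h3) (h4.trans ht))).trans_eq ?_)
      ring)
    rw [hpow hσ0 s t hs hst ht] at h1
    have h2 : ‖(y ξ - y s) (ω t - ω s)‖ ≤ A s t ^ r * (c * B s t ^ σ) :=
      ((y ξ - y s).le_opNorm _).trans (mul_le_mul
        ((hyA s ξ hs hξ.1 (hξ.2.trans ht)).trans (hAmono s ξ t hs hξ.1 hξ.2 ht))
        (hd' s t hs hst ht htd) (norm_nonneg _) (hA0 s t hs hst ht))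
    have hsplit : J t - J s - y ξ (ω t - ω s) =
        (J t - J s - Ξ s t) - (y ξ - y s) (ω t - ω s) := by
      simp only [Ξ, sub_apply]
      abel
    rw [hsplit]
    refine (norm_sub_le _ _).trans ((add_le_add h1 h2).trans_eq ?_)
    have : c * (2 * K' + 1) = ε := div_mul_cancel₀ _ (by positivity)
    linear_combination (A s t ^ r * B s t ^ σ) * this
  have hJunif : ∀ ε > 0, ∃ d > 0, ∀ s t, a ≤ s → s ≤ t → t ≤ b → t - s < d →
      ‖J t - J s‖ < ε := by
    intro ε hε
    obtain ⟨C, hC⟩ := isCompact_Icc.exists_bound_of_continuousOn hyc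
    have hC0 : 0 ≤ C := (norm_nonneg _).trans (hC a ⟨le_rfl, hab⟩)
    have hAB0 : 0 ≤ A a b ^ r * B a b ^ σ :=
      mul_nonneg (hA0 a b le_rfl hab le_rfl) (hB0 σ a b le_rfl hab le_rfl)
    obtain ⟨d₁, hd₁, h1⟩ := hlocal (ε / 2 / (A a b ^ r * B a b ^ σ + 1)) (by positivity)
    obtain ⟨d₂, hd₂, h2⟩ := hωu (ε / 2 / (C + 1)) (by positivity)
    refine ⟨min d₁ d₂, lt_min hd₁ hd₂, fun s t hs hst ht htd => ?_⟩
    have e1 := h1 s t hs hst ht (htd.trans_le (min_le_left _ _)) s ⟨le_rfl, hst⟩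
    have e2 := h2 s ⟨hs, hst.trans ht⟩ t ⟨hs.trans hst, ht⟩ (by
      rw [dist_comm, Real.dist_eq, abs_lt]
      have := htd.trans_le (min_le_right d₁ d₂)
      constructor <;> linarith)
    rw [dist_comm, dist_eq_norm] at e2
    have e3 : ‖y s (ω t - ω s)‖ ≤ C * (ε / 2 / (C + 1)) :=
      ((y s).le_opNorm _).trans (mul_le_mul (hC s ⟨hs, hst.trans ht⟩) e2.le (norm_nonneg _) hC0)
    have e4 : A s t ^ r * B s t ^ σ ≤ A a b ^ r * B a b ^ σ :=
      mul_le_mul (Real.rpow_le_rpow (hA.nonneg s t hs hst ht)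
        (hA.mono le_rfl hs hst ht le_rfl) hr.le)
        (Real.rpow_le_rpow (hB.nonneg s t hs hst ht) (hB.mono le_rfl hs hst ht le_rfl) hσ0.le)
        (hB0 σ s t hs hst ht) (hA0 a b le_rfl hab le_rfl)
    have e5 : ε / 2 / (A a b ^ r * B a b ^ σ + 1) * (A s t ^ r * B s t ^ σ) < ε / 2 := by
      rw [div_mul_eq_mul_div, div_lt_iff₀ (by positivity)]
      exact mul_lt_mul_of_pos_left (by linarith) (by positivity)
    have e6 : C * (ε / 2 / (C + 1)) ≤ ε / 2 := by
      rw [mul_div_assoc', div_le_iff₀ (by positivity), mul_comm]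
      exact mul_le_mul_of_nonneg_left (by linarith) (by positivity)
    calc ‖J t - J s‖ = ‖(J t - J s - y s (ω t - ω s)) + y s (ω t - ω s)‖ := by
          rw [sub_add_cancel]
      _ ≤ _ := norm_add_le _ _
      _ < ε := by linarith
  have hJc : ContinuousOn J (Icc a b) := by
    refine Metric.continuousOn_iff.2 fun u hu ε hε => ?_
    obtain ⟨d, hd, h⟩ := hJunif ε hε
    refine ⟨d, hd, fun v hv hvu => ?_⟩
    rw [Real.dist_eq, abs_lt] at hvu
    rcases le_total u v with huv | huv
    · rw [dist_eq_norm]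
      exact h u v hu.1 huv hv.2 (by linarith)
    · rw [dist_comm, dist_eq_norm]
      exact h v u hv.1 huv hu.2 (by linarith)
  refine ⟨J, hJc, fun t ht ε hε => ?_, fun s t hs hst ht => ?_⟩
  · have hAB0 : 0 ≤ A a t ^ r * B a t ^ σ :=
      mul_nonneg (hA0 a t le_rfl ht.1 ht.2) (hB0 σ a t le_rfl ht.1 ht.2)
    set e := ε / (A a t ^ r * B a t ^ σ + 1) with he
    have he0 : 0 < e := by positivity
    obtain ⟨d, hd, h⟩ := hlocal e he0
    refine ⟨d, hd, fun P hP => ?_⟩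
    obtain ⟨τ, h1, h2, h3, h4⟩ := exists_nat_partition P.mono
    rw [P.first] at h2
    rw [P.last] at h3
    have htel : J t - J a = ∑ i : Fin P.n, (J (P.t i.succ) - J (P.t i.castSucc)) := by
      have := Finset.sum_range_sub (fun i => J (τ i)) P.n
      rw [h2, h3, Finset.sum_range] at this
      rw [← this]
      exact Finset.sum_congr rfl fun i _ => by rw [(h4 i).1, (h4 i).2]
    have hrange : ∀ i : Fin P.n, a ≤ P.t i.castSucc ∧ P.t i.succ ≤ t := fun i =>
      ⟨P.first.symm.trans_le (P.mono.monotone (Fin.zero_le _)),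
        (P.mono.monotone (Fin.le_last _)).trans_eq P.last⟩
    have hlt : ∀ i : Fin P.n, P.t i.castSucc ≤ P.t i.succ := fun i =>
      (P.mono (Fin.castSucc_lt_succ)).le
    have hsum := (hV'.mono_Icc le_rfl ht.2).rpow hσr.le |>.sum_le τ P.n
      (fun i hi => (h1 i hi).le) h2.ge h3.le
    rw [h2, h3, hpow hσ0 a t le_rfl ht.1 ht.2, Finset.sum_range] at hsum
    have hcell : ∀ i : Fin P.n, ‖y (P.tag i) (ω (P.t i.succ) - ω (P.t i.castSucc)) -
        (J (P.t i.succ) - J (P.t i.castSucc))‖ ≤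
        e * (A (τ i) (τ (i + 1)) ^ (r / (σ + r)) *
          B (τ i) (τ (i + 1)) ^ (σ / (σ + r))) ^ (σ + r) := fun i => by
      rw [(h4 i).1, (h4 i).2, hpow hσ0 _ _ (hrange i).1 (hlt i) ((hrange i).2.trans ht.2),
        norm_sub_rev]
      exact h _ _ (hrange i).1 (hlt i) ((hrange i).2.trans ht.2)
        (TaggedPartition.sub_lt_of_mesh_lt hP i) _ (P.tag_mem i)
    rw [htel, RSSum, ← Finset.sum_sub_distrib]
    refine ((norm_sum_le _ _).trans (Finset.sum_le_sum fun i _ => hcell i)).trans_lt ?_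
    rw [← Finset.mul_sum]
    refine (mul_le_mul_of_nonneg_left hsum.2 he0.le).trans_lt ?_
    rw [he, div_mul_eq_mul_div, div_lt_iff₀ (by positivity)]
    exact mul_lt_mul_of_pos_left (by linarith) hε
  · have hΞc : ContinuousOn (fun pr : ℝ × ℝ => Ξ pr.1 pr.2) (Icc a b ×ˢ Icc a b) := by
      have c1 : ContinuousOn (fun pr : ℝ × ℝ => y pr.1) (Icc a b ×ˢ Icc a b) :=
        hyc.comp continuousOn_fst fun pr hpr => hpr.1
      have c2 : ContinuousOn (fun pr : ℝ × ℝ => ω pr.1) (Icc a b ×ˢ Icc a b) :=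
        hωc.comp continuousOn_fst fun pr hpr => hpr.1
      have c3 : ContinuousOn (fun pr : ℝ × ℝ => ω pr.2) (Icc a b ×ˢ Icc a b) :=
        hωc.comp continuousOn_snd fun pr hpr => hpr.2
      exact c1.clm_apply (c3.sub c2)
    have hK0 : 0 < (1 - (2:ℝ) ^ (1 - (ρ + r)))⁻¹ :=
      inv_pos.2 (by linarith [two_rpow_one_sub_lt_one hθ])
    have := norm_sewing_le hV hθ (show 0 ≤ 2 * 1 * (1 - (2:ℝ) ^ (1 - (ρ + r)))⁻¹ by positivity)
      hJc hΞc hΞ0 hΞ (fun u v h1 h2 h3 => hJ u v _ _ 1 h1 h2 h3 (hV.mono_Icc h1 h3) hθ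
        zero_le_one fun u' v' w' k1 k2 k3 k4 => by
          rw [one_mul]
          exact hΞ u' v' w' (h1.trans k1) k2 k3 (k4.trans h3)) hs hst ht
    rwa [hpow hρ s t hs hst ht] at this

end Young

open MeasureTheory in
/-- Hölder's inequality against the constant function on an interval. -/
lemma integral_abs_le_rpow_mul {b : ℝ → ℝ} {α s t : ℝ} (hα0 : 0 < α) (hα1 : α < 1)
    (hst : s ≤ t) (hb : IntervalIntegrable (fun u => |b u| ^ (1 / (1 - α))) volume s t) :
    IntervalIntegrable (fun u => |b u|) volume s t ∧
    ∫ u in s..t, |b u| ≤ (t - s) ^ α * (∫ u in s..t, |b u| ^ (1 / (1 - α))) ^ (1 - α) := by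
  have h1α : 0 < 1 - α := by linarith
  set r := 1 / (1 - α) with hr
  have hr0 : 0 < r := by positivity
  have hrinv : 1 / r = 1 - α := by rw [hr, one_div_one_div]
  rw [intervalIntegrable_iff_integrableOn_Ioc_of_le hst] at hb
  have hmeas : AEStronglyMeasurable (fun u => |b u|) (volume.restrict (Ioc s t)) := by
    have := (hb.aestronglyMeasurable.aemeasurable.pow_const (1 - α)).aestronglyMeasurable
    refine this.congr (Filter.Eventually.of_forall fun u => ?_)
    change (|b u| ^ r) ^ (1 - α) = |b u|
    rw [← Real.rpow_mul (abs_nonneg _), ← hrinv, mul_one_div_cancel hr0.ne', Real.rpow_one]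
  have hmem : MemLp (fun u => |b u|) (ENNReal.ofReal r) (volume.restrict (Ioc s t)) := by
    rw [← integrable_norm_rpow_iff hmeas (by simpa using hr0) ENNReal.ofReal_ne_top,
      ENNReal.toReal_ofReal hr0.le]
    simpa using! hb
  have hconj : (1 / α).HolderConjugate r := by
    rw [Real.holderConjugate_iff, one_lt_div hα0]
    refine ⟨hα1, ?_⟩
    rw [hr]
    simp
  have hone : MemLp (fun _ : ℝ => (1:ℝ)) (ENNReal.ofReal (1 / α))
      (volume.restrict (Ioc s t)) := memLp_const 1
  have hint : Integrable (fun u => |b u|) (volume.restrict (Ioc s t)) := by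
    refine hmem.integrable ?_
    rw [← ENNReal.ofReal_one]
    refine ENNReal.ofReal_le_ofReal ?_
    rw [hr, le_div_iff₀ h1α]
    linarith
  refine ⟨(intervalIntegrable_iff_integrableOn_Ioc_of_le hst).2 hint, ?_⟩
  have := integral_mul_le_Lp_mul_Lq_of_nonneg hconj
    (Filter.Eventually.of_forall fun _ => zero_le_one)
    (Filter.Eventually.of_forall fun u => abs_nonneg (b u)) hone hmem
  rw [intervalIntegral.integral_of_le hst, intervalIntegral.integral_of_le hst]
  simpa [hrinv, hst, measureReal_def] using this

/-- Proposition `EstIJ`(i): under (H1)–(H3), for `x` continuous of finite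
`q`-variation on `[t0,t1] ⊆ [0,T]`, the map `F(x)` is a well-defined continuous path of
finite `q`-variation and
`|||F(x)|||_{q-var,[t0,t1]} ≤ M(K+2)(1 + ‖x‖_{q-var,[t0,t1]})((t1-t0)^α + |||ω|||_{p-var,[t0,t1]})`. -/
theorem stmt9
    {d m : ℕ} (p T : ℝ) (hp1 : 1 < p) (hp2 : p < 2) (hT : 0 < T)
    (f : ℝ → Ed d → Ed d) (g : ℝ → Ed d → (Ed m →L[ℝ] Ed d))
    (hf : ContinuousOn (fun pr : ℝ × Ed d => f pr.1 pr.2) (Set.Icc 0 T ×ˢ Set.univ))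
    (hg : ContinuousOn (fun pr : ℝ × Ed d => g pr.1 pr.2) (Set.Icc 0 T ×ˢ Set.univ))
    (Dg : ℝ → Ed d → (Ed d →L[ℝ] Ed m →L[ℝ] Ed d))
    (hDg : ∀ t ∈ Set.Icc (0:ℝ) T, ∀ x : Ed d, HasFDerivAt (g t) (Dg t x) x)
    (β δ Lg : ℝ) (hβ0 : 0 < β) (hβ1 : β ≤ 1) (hδ0 : 0 < δ) (hδ1 : δ ≤ 1) (hLg : 0 < Lg)
    (h : ℝ → ℝ → ℝ) (hctrl : IsControlOn 0 T h)
    (MN : ℝ → ℝ) (hMN : ∀ N : ℝ, 0 ≤ N → 0 < MN N)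
    (H1i : ∀ t ∈ Set.Icc (0:ℝ) T, ∀ x y : Ed d, ‖g t x - g t y‖ ≤ Lg * ‖x - y‖)
    (H1ii : ∀ N : ℝ, 0 ≤ N → ∀ t ∈ Set.Icc (0:ℝ) T, ∀ x y : Ed d, ‖x‖ ≤ N → ‖y‖ ≤ N →
      ‖Dg t x - Dg t y‖ ≤ MN N * ‖x - y‖ ^ δ)
    (H1iii : ∀ s t : ℝ, 0 ≤ s → s < t → t ≤ T → ∀ x : Ed d,
      ‖g t x - g s x‖ + ‖Dg t x - Dg s x‖ ≤ h s t ^ β)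
    (a α : ℝ) (b : ℝ → ℝ) (ha : 0 < a) (hα1 : 1 / 2 ≤ α) (hα2 : α < 1)
    (hbmem : IntervalIntegrable (fun s => |b s| ^ (1 / (1 - α))) MeasureTheory.volume 0 T)
    (LN : ℝ → ℝ) (hLN : ∀ N : ℝ, 0 ≤ N → 0 < LN N)
    (H2i : ∀ N : ℝ, 0 ≤ N → ∀ t ∈ Set.Icc (0:ℝ) T, ∀ x y : Ed d, ‖x‖ ≤ N → ‖y‖ ≤ N →
      ‖f t x - f t y‖ ≤ LN N * ‖x - y‖)
    (H2ii : ∀ t ∈ Set.Icc (0:ℝ) T, ∀ x : Ed d, ‖f t x‖ ≤ a * ‖x‖ + b t)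
    (H3a : p - 1 < δ) (H3b : 1 - 1 / p < β) (H3c : 1 - 1 / p < δ * α)
    (q0 q : ℝ)
    (hq0a : 1 - 1 / p < 1 / q0)
    (hq0b : 1 / q0 < min (min β (δ * α)) (min (δ / p) (1 / 2)))
    (hqa : 1 / (q0 * δ) ≤ 1 / q) (hqb : 1 / q < min α (1 / p))
    (ω : ℝ → Ed m) (hω : ContinuousOn ω (Set.Icc 0 T)) (hωp : FinitePVar p ω 0 T)
    (t0 t1 : ℝ) (ht0 : 0 ≤ t0) (ht01 : t0 ≤ t1) (ht1 : t1 ≤ T)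
    (x : ℝ → Ed d) (hx : ContinuousOn x (Set.Icc t0 t1)) (hxq : FinitePVar q x t0 t1) :
    (∀ t ∈ Set.Icc t0 t1, ∃ v : Ed d, IsYoungIntegral (fun s => g s (x s)) ω t0 t v) ∧
    ContinuousOn (Fmap f g ω t0 x) (Set.Icc t0 t1) ∧
    FinitePVar q (Fmap f g ω t0 x) t0 t1 ∧
    pVar q (Fmap f g ω t0 x) t0 t1 ≤
      (max (max Lg (a * T ^ (1 - α))) (max (‖g 0 0‖ + h 0 T ^ β) ((∫ s in (0:ℝ)..T, |b s| ^ (1 / (1 - α))) ^ (1 - α)))) * ((1 - (2:ℝ) ^ (1 - (1 / p + 1 / q0)))⁻¹ + 2) *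
        (1 + pVarNorm q x t0 t1) * ((t1 - t0) ^ α + pVar p ω t0 t1) := by
  have hmin := lt_min_iff.1 hq0b
  have hmin1 := lt_min_iff.1 hmin.1
  have hp0 : 0 < p := by linarith
  have h1p : 1 / p < 1 := (div_lt_one hp0).2 hp1
  have hq0inv : 0 < 1 / q0 := by linarith
  have hq0pos : 0 < q0 := one_div_pos.1 hq0inv
  have hq0δ : 0 < 1 / (q0 * δ) := by positivity
  have hqpos : 0 < q := one_div_pos.1 (hq0δ.trans_le hqa)
  have hqα : 1 < α * q := (div_lt_iff₀ hqpos).1 (lt_min_iff.1 hqb).1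
  have hqp : 1 < 1 / p * q := (div_lt_iff₀ hqpos).1 (lt_min_iff.1 hqb).2
  have hq1 : 1 ≤ q := by
    have : 1 / p * q ≤ 1 * q := mul_le_mul_of_nonneg_right h1p.le hqpos.le
    linarith
  have hq0β : 1 < β * q0 := (div_lt_iff₀ hq0pos).1 hmin1.1
  have hqq0 : 1 ≤ 1 / q * q0 := by
    have h1 : 1 / q0 ≤ 1 / (q0 * δ) :=
      one_div_le_one_div_of_le (by positivity) (mul_le_of_le_one_right hq0pos.le hδ1)
    exact (div_le_iff₀ hq0pos).1 (h1.trans hqa)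
  have hq01 : 1 ≤ q0 := by nlinarith
  have hα0 : 0 < α := by linarith
  have hθ : 1 < 1 / p + 1 / q0 := by linarith
  set M := max (max Lg (a * T ^ (1 - α))) (max (‖g 0 0‖ + h 0 T ^ β)
    ((∫ s in (0:ℝ)..T, |b s| ^ (1 / (1 - α))) ^ (1 - α))) with hM
  set K := (1 - (2:ℝ) ^ (1 - (1 / p + 1 / q0)))⁻¹ with hK
  set N := pVarNorm q x t0 t1 with hN
  have hM1 : Lg ≤ M := (le_max_left _ _).trans (le_max_left _ _)
  have hM2 : a * T ^ (1 - α) ≤ M := (le_max_right _ _).trans (le_max_left _ _)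
  have hM3 : ‖g 0 0‖ + h 0 T ^ β ≤ M := (le_max_left _ _).trans (le_max_right _ _)
  have hM4 : (∫ s in (0:ℝ)..T, |b s| ^ (1 / (1 - α))) ^ (1 - α) ≤ M :=
    (le_max_right _ _).trans (le_max_right _ _)
  have hM0 : 0 ≤ M := hLg.le.trans hM1
  have hK0 : 0 < K := inv_pos.2 (by linarith [two_rpow_one_sub_lt_one hθ])
  have hsub : Icc t0 t1 ⊆ Icc 0 T := Icc_subset_Icc ht0 ht1
  have hX := hxq.isSuperadditiveOn
  have hB := (hωp.mono ht0 ht1).isSuperadditiveOn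
  have hh : IsSuperadditiveOn 0 T h := ⟨hctrl.2.2.2, hctrl.2.2.1⟩
  have hXmono : ∀ s t, t0 ≤ s → s ≤ t → t ≤ t1 → pVar q x s t ≤ pVar q x t0 t1 :=
    fun s t h1 h2 h3 => Real.rpow_le_rpow (hX.nonneg s t h1 h2 h3)
      (hX.mono le_rfl h1 h2 h3 le_rfl) (by positivity)
  have hhmono : ∀ s t, 0 ≤ s → s ≤ t → t ≤ T → h s t ^ β ≤ h 0 T ^ β :=
    fun s t h1 h2 h3 => Real.rpow_le_rpow (hh.nonneg s t h1 h2 h3)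
      (hh.mono le_rfl h1 h2 h3 le_rfl) hβ0.le
  have hX0 : 0 ≤ pVar q x t0 t1 := Real.rpow_nonneg (hX.nonneg t0 t1 le_rfl ht01 le_rfl) _
  have hN0 : 0 ≤ N := add_nonneg (norm_nonneg _) hX0
  have hxN : ∀ s ∈ Icc t0 t1, ‖x s‖ ≤ N := fun s hs => by
    have h1 := hxq.norm_sub_le hqpos le_rfl hs.1 hs.2
    have h2 := hXmono t0 s le_rfl hs.1 hs.2
    have h3 := norm_sub_norm_le (x s) (x t0)
    rw [hN, pVarNorm]
    linarith
  have hgt : ∀ s t, 0 ≤ s → s ≤ t → t ≤ T → ∀ z, ‖g t z - g s z‖ ≤ h s t ^ β := by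
    intro s t h1 h2 h3 z
    rcases h2.eq_or_lt with rfl | h2
    · rw [sub_self, norm_zero]
      exact Real.rpow_nonneg (hh.nonneg s s h1 le_rfl h3) _
    · linarith [H1iii s t h1 h2 h3 z, norm_nonneg (Dg t z - Dg s z)]
  set y : ℝ → Ed m →L[ℝ] Ed d := fun s => g s (x s) with hy
  have hyN : ∀ s ∈ Icc t0 t1, ‖y s‖ ≤ M * (1 + N) := fun s hs => by
    have hsT := hsub hs
    have h1 := H1i s hsT (x s) 0
    have h2 := (hgt 0 s le_rfl hsT.1 hsT.2 0).trans (hhmono 0 s le_rfl hsT.1 hsT.2)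
    have h3 : ‖y s‖ ≤ ‖g s (x s) - g s 0‖ + ‖g s 0 - g 0 0‖ + ‖g 0 0‖ := by
      calc ‖y s‖ = ‖(g s (x s) - g s 0) + (g s 0 - g 0 0) + g 0 0‖ := by
            rw [sub_add_sub_cancel, sub_add_cancel]
        _ ≤ _ := norm_add₃_le
    rw [sub_zero] at h1
    have h4 := mul_le_mul hM1 (hxN s hs) (norm_nonneg _) hM0
    linarith
  have hyinc : ∀ u v, t0 ≤ u → u ≤ v → v ≤ t1 → ‖y v - y u‖ ≤
      Lg * sSup (pVarSums q x u v) ^ (1 / q) + 1 * h u v ^ β := by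
    intro u v h1 h2 h3
    have e1 := H1i v (hsub ⟨h1.trans h2, h3⟩) (x v) (x u)
    have e2 := hgt u v (ht0.trans h1) h2 (h3.trans ht1) (x u)
    have e3 := mul_le_mul_of_nonneg_left (hxq.norm_sub_le hqpos h1 h2 h3) hLg.le
    rw [pVar] at e3
    have e4 : ‖y v - y u‖ ≤ ‖g v (x v) - g v (x u)‖ + ‖g v (x u) - g u (x u)‖ := by
      rw [← sub_add_sub_cancel (y v) (g v (x u)) (y u)]
      exact norm_add_le _ _
    linarith
  have hysum : ∀ s t, t0 ≤ s → s ≤ t → t ≤ t1 → ∀ v ∈ pVarSums q0 y s t,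
      v ≤ (Lg * sSup (pVarSums q x s t) ^ (1 / q) + 1 * h s t ^ β) ^ q0 :=
    fun s t h1 h2 h3 => pVarSums_le_of_norm_sub_le hq01 hX (hh.mono_Icc ht0 ht1) hqq0 hq0β.le
      hLg.le zero_le_one hyinc h1 h2 h3
  have hyvar : FinitePVar q0 y t0 t1 := ⟨_, hysum t0 t1 le_rfl ht01 le_rfl⟩
  have hyM : ∀ s t, t0 ≤ s → s ≤ t → t ≤ t1 → pVar q0 y s t ≤ M * (1 + N) := by
    intro s t h1 h2 h3
    have e0 : 0 ≤ h s t ^ β :=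
      Real.rpow_nonneg (hh.nonneg s t (ht0.trans h1) h2 (h3.trans ht1)) _
    have e1 : 0 ≤ pVar q x s t := Real.rpow_nonneg (hX.nonneg s t h1 h2 h3) _
    refine (pVar_le_of_forall_le hq0pos h2 (add_nonneg (mul_nonneg hLg.le e1)
      (by linarith)) (hysum s t h1 h2 h3)).trans ?_
    change Lg * pVar q x s t + _ ≤ _
    have e2 := hhmono s t (ht0.trans h1) h2 (h3.trans ht1)
    have e3 : pVar q x s t ≤ N :=
      (hXmono s t h1 h2 h3).trans (le_add_of_nonneg_left (norm_nonneg _))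
    have e4 := mul_le_mul hM1 e3 e1 hM0
    linarith [norm_nonneg (g 0 0)]
  have hpair : ContinuousOn (fun s => (s, x s)) (Icc t0 t1) := continuousOn_id.prodMk hx
  have hyc : ContinuousOn y (Icc t0 t1) :=
    hg.comp hpair fun s hs => ⟨hsub hs, mem_univ _⟩
  obtain ⟨J, hJc, hJy, hJe⟩ := exists_young_integral ht01 hyvar.isSuperadditiveOn hB hq0inv
    (one_div_pos.2 hp0) hθ hyc (hω.mono hsub)
    (fun u v h1 h2 h3 => hyvar.norm_sub_le hq0pos h1 h2 h3)
    (fun u v h1 h2 h3 => (hωp.mono ht0 ht1).norm_sub_le hp0 h1 h2 h3)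
  have hJinc : ∀ s t, t0 ≤ s → s ≤ t → t ≤ t1 → ‖J t - J s‖ ≤
      M * (1 + N) * (K + 1) * sSup (pVarSums p ω s t) ^ (1 / p) := by
    intro s t h1 h2 h3
    have e1 := hJe s t h1 h2 h3
    have e2 : ‖y s (ω t - ω s)‖ ≤ M * (1 + N) * pVar p ω s t :=
      ((y s).le_opNorm _).trans (mul_le_mul (hyN s ⟨h1, h2.trans h3⟩)
        ((hωp.mono ht0 ht1).norm_sub_le hp0 h1 h2 h3) (norm_nonneg _) (by positivity))
    have e3 : pVar q0 y s t * pVar p ω s t ≤ M * (1 + N) * pVar p ω s t :=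
      mul_le_mul_of_nonneg_right (hyM s t h1 h2 h3)
        (Real.rpow_nonneg (hB.nonneg s t h1 h2 h3) _)
    have e4 := mul_le_mul_of_nonneg_left e3 hK0.le
    change _ ≤ K * (pVar q0 y s t * pVar p ω s t) at e1
    change _ ≤ M * (1 + N) * (K + 1) * pVar p ω s t
    have e5 : ‖J t - J s‖ ≤ ‖J t - J s - y s (ω t - ω s)‖ + ‖y s (ω t - ω s)‖ := by
      simpa using norm_add_le (J t - J s - y s (ω t - ω s)) (y s (ω t - ω s))
    linarith
  have hfc : ContinuousOn (fun s => f s (x s)) (Icc t0 t1) :=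
    hf.comp hpair fun s hs => ⟨hsub hs, mem_univ _⟩
  have hfint : ∀ s t, t0 ≤ s → s ≤ t → t ≤ t1 →
      IntervalIntegrable (fun s => f s (x s)) MeasureTheory.volume s t := fun s t h1 h2 h3 =>
    (hfc.mono (by rw [uIcc_of_le h2]; exact Icc_subset_Icc h1 h3)).intervalIntegrable
  have hIinc : ∀ s t, t0 ≤ s → s ≤ t → t ≤ t1 → ‖∫ u in s..t, f u (x u)‖ ≤
      M * (1 + N) * (t - s) ^ α := by
    intro s t h1 h2 h3
    have hs0 : 0 ≤ s := ht0.trans h1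
    have htT : t ≤ T := h3.trans ht1
    have hbint := hbmem.mono_set (by
      rw [uIcc_of_le h2, uIcc_of_le hT.le]
      exact Icc_subset_Icc hs0 htT)
    obtain ⟨k1, k2⟩ := integral_abs_le_rpow_mul hα0 hα2 h2 hbint
    have e1 : ‖∫ u in s..t, f u (x u)‖ ≤ ∫ u in s..t, (a * N + |b u|) := by
      refine intervalIntegral.norm_integral_le_of_norm_le h2
        (Filter.Eventually.of_forall fun u hu => ?_) (intervalIntegrable_const.add k1)
      have hu' : u ∈ Icc t0 t1 := ⟨h1.trans hu.1.le, hu.2.trans h3⟩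
      exact (H2ii u (hsub hu') (x u)).trans
        (add_le_add (mul_le_mul_of_nonneg_left (hxN u hu') ha.le) (le_abs_self _))
    rw [intervalIntegral.integral_add intervalIntegrable_const k1,
      intervalIntegral.integral_const, smul_eq_mul] at e1
    have hts : 0 ≤ t - s := by linarith
    have hpow0 : 0 ≤ (t - s) ^ α := Real.rpow_nonneg hts _
    have e2 : (∫ u in s..t, |b u| ^ (1 / (1 - α))) ^ (1 - α) ≤ M := by
      refine (Real.rpow_le_rpow (intervalIntegral.integral_nonneg h2 fun u _ =>
        Real.rpow_nonneg (abs_nonneg _) _) ?_ (by linarith)).trans hM4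
      exact intervalIntegral.integral_mono_interval hs0 h2 htT
        (Filter.Eventually.of_forall fun u => Real.rpow_nonneg (abs_nonneg _) _) hbmem
    have e3 : t - s ≤ T ^ (1 - α) * (t - s) ^ α := by
      calc t - s = (t - s) ^ (1 - α) * (t - s) ^ α := by
            rw [← Real.rpow_add_of_nonneg hts (by linarith) hα0.le, sub_add_cancel, Real.rpow_one]
        _ ≤ _ := mul_le_mul_of_nonneg_right
            (Real.rpow_le_rpow hts (by linarith) (by linarith)) hpow0
    have e4 : (t - s) * (a * N) ≤ M * N * (t - s) ^ α := by
      calc (t - s) * (a * N) ≤ (T ^ (1 - α) * (t - s) ^ α) * (a * N) :=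
            mul_le_mul_of_nonneg_right e3 (mul_nonneg ha.le hN0)
        _ = (a * T ^ (1 - α)) * (N * (t - s) ^ α) := by ring
        _ ≤ M * (N * (t - s) ^ α) := mul_le_mul_of_nonneg_right hM2 (by positivity)
        _ = _ := by ring
    have e5 := mul_le_mul_of_nonneg_left e2 hpow0
    linarith
  have hFeq : ∀ t ∈ Icc t0 t1, Fmap f g ω t0 x t =
      x t0 + (∫ s in t0..t, f s (x s)) + (J t - J t0) := fun t ht => by
    rw [Fmap, (hJy t ht).youngIntegral_eq ht.1]
  have hFinc : ∀ u v, t0 ≤ u → u ≤ v → v ≤ t1 → ‖Fmap f g ω t0 x v - Fmap f g ω t0 x u‖ ≤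
      M * (1 + N) * (v - u) ^ α +
        M * (1 + N) * (K + 1) * sSup (pVarSums p ω u v) ^ (1 / p) := by
    intro u v h1 h2 h3
    have hadd := intervalIntegral.integral_add_adjacent_intervals
      (hfint t0 u le_rfl h1 (h2.trans h3)) (hfint u v h1 h2 h3)
    have : Fmap f g ω t0 x v - Fmap f g ω t0 x u =
        (∫ s in u..v, f s (x s)) + (J v - J u) := by
      rw [hFeq u ⟨h1, h2.trans h3⟩, hFeq v ⟨h1.trans h2, h3⟩, ← hadd]
      abel
    rw [this]
    exact (norm_add_le _ _).trans (add_le_add (hIinc u v h1 h2 h3) (hJinc u v h1 h2 h3))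
  have hlen : IsSuperadditiveOn t0 t1 (fun s t => t - s) :=
    ⟨fun s t _ h2 _ => by linarith, fun s t u _ _ _ _ => by linarith⟩
  have hFsum := pVarSums_le_of_norm_sub_le hq1 hlen hB hqα.le hqp.le
    (show 0 ≤ M * (1 + N) by positivity) (show 0 ≤ M * (1 + N) * (K + 1) by positivity)
    hFinc le_rfl ht01 le_rfl
  have hω0 : 0 ≤ pVar p ω t0 t1 := Real.rpow_nonneg (hB.nonneg t0 t1 le_rfl ht01 le_rfl) _
  have hd0 : 0 ≤ (t1 - t0) ^ α := Real.rpow_nonneg (by linarith) _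
  refine ⟨fun t ht => ⟨_, hJy t ht⟩, ?_, ⟨_, hFsum⟩, ?_⟩
  · refine ContinuousOn.congr ?_ hFeq
    have hprim := intervalIntegral.continuousOn_primitive_interval
      (μ := MeasureTheory.volume) (f := fun s => f s (x s)) (a := t0) (b := t1) (by
        rw [uIcc_of_le ht01]
        exact hfc.integrableOn_Icc)
    rw [uIcc_of_le ht01] at hprim
    exact (continuousOn_const.add hprim).add (hJc.sub continuousOn_const)
  · refine (pVar_le_of_forall_le hqpos ht01 (add_nonneg (mul_nonneg (by positivity) hd0)
      (mul_nonneg (by positivity) hω0)) hFsum).trans ?_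
    change M * (1 + N) * (t1 - t0) ^ α + M * (1 + N) * (K + 1) * pVar p ω t0 t1 ≤ _
    have e1 : 0 ≤ M * (1 + N) * (K + 1) * (t1 - t0) ^ α := by positivity
    have e2 : 0 ≤ M * (1 + N) * pVar p ω t0 t1 := by positivity
    linarith
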